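/- Let H be an infinite-dimensional complex Hilbert space and let f be the free holomorphic function with scalar coefficients a = (a_α)_{α∈𝔽ₙ⁺} on the unit ball (γ = 1). Then sup_{X ∈ [B(H)ⁿ]₁} ‖f_H(X)‖ < ∞ if and only if sup_{m ∈ ℕ} ‖Σ_{|α| ≤ m} a_α S_α^(m)‖ < ∞; and in that case the two suprema are equal. -/

import Mathlib

open scoped ENNReal ComplexOrder
open Filter ContinuousLinearMap

noncomputable section

abbrev Word (n : ℕ) := FreeMonoid (Fin n)

/-- The word determined by a tuple of letters. -/
def word {n k : ℕ} (f : Fin k → Fin n) : Word n :=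
  FreeMonoid.ofList (List.ofFn f)

/-- The length of a word. -/
def wordLen {n : ℕ} (α : Word n) : ℕ := (FreeMonoid.toList α).length

/-- The product `X_α = X_{i₁} ⋯ X_{i_k}` for `α = g_{i₁} ⋯ g_{i_k}`. -/
def wordProd {n : ℕ} {K : Type} [NormedAddCommGroup K] [InnerProductSpace ℂ K]
    (X : Fin n → K →L[ℂ] K) (α : Word n) : K →L[ℂ] K :=
  ((FreeMonoid.toList α).map X).prod

/-- `Σ_{|α| = k} a_α X_α`. -/
def truncSum {n : ℕ} {K : Type} [NormedAddCommGroup K] [InnerProductSpace ℂ K]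
    (a : Word n → ℂ) (X : Fin n → K →L[ℂ] K) (k : ℕ) : K →L[ℂ] K :=
  ∑ f : Fin k → Fin n, a (word f) • wordProd X (word f)

/-- `Σ_{|α| = k} b_α X_α*`. -/
def truncSumAdj {n : ℕ} {K : Type} [NormedAddCommGroup K] [InnerProductSpace ℂ K]
    [CompleteSpace K] (b : Word n → ℂ) (X : Fin n → K →L[ℂ] K) (k : ℕ) : K →L[ℂ] K :=
  ∑ f : Fin k → Fin n, b (word f) • adjoint (wordProd X (word f))

/-- The free holomorphic function `f(X) = Σ_k Σ_{|α| = k} a_α X_α`. -/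
def holOp {n : ℕ} {K : Type} [NormedAddCommGroup K] [InnerProductSpace ℂ K]
    (a : Word n → ℂ) (X : Fin n → K →L[ℂ] K) : K →L[ℂ] K :=
  ∑' k : ℕ, truncSum a X k

/-- The free pluriharmonic function
`u(X) = Σ_{k ≥ 1} Σ_{|α| = k} b_α X_α* + a_{g₀} I + Σ_{k ≥ 1} Σ_{|α| = k} a_α X_α`. -/
def phOp {n : ℕ} {K : Type} [NormedAddCommGroup K] [InnerProductSpace ℂ K]
    [CompleteSpace K] (a b : Word n → ℂ) (X : Fin n → K →L[ℂ] K) : K →L[ℂ] K :=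
  (∑' k : ℕ, truncSumAdj b X (k + 1)) + a 1 • (1 : K →L[ℂ] K)
    + ∑' k : ℕ, truncSum a X (k + 1)

/-- Membership in the open noncommutative ball of radius `γ`. -/
def inBall {n : ℕ} {K : Type} [NormedAddCommGroup K] [InnerProductSpace ℂ K]
    [CompleteSpace K] (γ : ℝ) (X : Fin n → K →L[ℂ] K) : Prop :=
  ‖∑ i, X i * adjoint (X i)‖ < γ ^ 2

/-- Membership in the closed noncommutative ball of radius `γ`. -/
def inClosedBall {n : ℕ} {K : Type} [NormedAddCommGroup K] [InnerProductSpace ℂ K]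
    [CompleteSpace K] (γ : ℝ) (X : Fin n → K →L[ℂ] K) : Prop :=
  ‖∑ i, X i * adjoint (X i)‖ ≤ γ ^ 2

/-- The radius-`γ` condition `limsup_k (Σ_{|α|=k} |a_α|²)^{1/(2k)} ≤ 1/γ`. -/
def radCond {n : ℕ} (γ : ℝ) (a : Word n → ℂ) : Prop :=
  Filter.limsup
    (fun k : ℕ =>
      (∑ f : Fin k → Fin n, (‖a (word f)‖₊ : ℝ≥0∞) ^ 2) ^ ((1 : ℝ) / (2 * (k : ℝ))))
    Filter.atTop ≤ ENNReal.ofReal (1 / γ)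

/-- The coefficients of the radial function: `α ↦ r^{|α|} a_α`. -/
def scaleCoef {n : ℕ} (r : ℝ) (a : Word n → ℂ) : Word n → ℂ :=
  fun α => ((r : ℂ) ^ wordLen α) * a α

/-- Positivity of the free pluriharmonic function with coefficients `(a, b)` on the
noncommutative ball of radius `γ` of every complex Hilbert space. -/
def posPH {n : ℕ} (γ : ℝ) (a b : Word n → ℂ) : Prop :=
  ∀ (K : Type) [NormedAddCommGroup K] [InnerProductSpace ℂ K] [CompleteSpace K],
    ∀ X : Fin n → K →L[ℂ] K, inBall γ X → (phOp a b X).IsPositive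


section Aux

theorem wordLen_word {n k : ℕ} (f : Fin k → Fin n) : wordLen (word f) = k := by
  simp [wordLen, word]

theorem wordLen_mul {n : ℕ} (α β : Word n) : wordLen (α * β) = wordLen α + wordLen β := by
  simp [wordLen]

theorem word_inj {n k : ℕ} : Function.Injective (word : (Fin k → Fin n) → Word n) := by
  intro f g h
  exact List.ofFn_injective (FreeMonoid.ofList.injective h)

theorem exists_word {n : ℕ} (α : Word n) : ∃ f : Fin (wordLen α) → Fin n, word f = α := by
  refine ⟨fun i => (FreeMonoid.toList α).get i, ?_⟩
  exact congrArg FreeMonoid.ofList (List.ofFn_get (FreeMonoid.toList α))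

theorem wordLen_one {n : ℕ} : wordLen (1 : Word n) = 0 := rfl

open Classical in
def wordsLE (n m : ℕ) : Finset (Word n) :=
  (Finset.range (m + 1)).biUnion fun k => Finset.univ.image (word : (Fin k → Fin n) → Word n)

theorem mem_wordsLE {n m : ℕ} {α : Word n} : α ∈ wordsLE n m ↔ wordLen α ≤ m := by
  classical
  simp only [wordsLE, Finset.mem_biUnion, Finset.mem_range, Finset.mem_image, Finset.mem_univ,
    true_and]
  constructor
  · rintro ⟨k, hk, f, rfl⟩
    rw [wordLen_word]; omega
  · intro h
    obtain ⟨f, hf⟩ := exists_word α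
    exact ⟨wordLen α, by omega, f, hf⟩

theorem sum_wordsLE {n m : ℕ} {E : Type*} [AddCommMonoid E] (g : Word n → E) :
    ∑ k ∈ Finset.range (m + 1), ∑ f : Fin k → Fin n, g (word f) = ∑ α ∈ wordsLE n m, g α := by
  classical
  unfold wordsLE
  rw [Finset.sum_biUnion]
  · refine Finset.sum_congr rfl fun k _ => ?_
    rw [Finset.sum_image]
    intro x _ y _ h
    exact word_inj h
  · intro i _ j _ hij
    simp only [Function.onFun]
    rw [Finset.disjoint_left]
    intro x hx hy
    simp only [Finset.mem_image, Finset.mem_univ, true_and] at hx hy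
    obtain ⟨f, rfl⟩ := hx
    obtain ⟨g, hg⟩ := hy
    apply hij
    rw [← wordLen_word f, ← hg, wordLen_word]

theorem word_cons {n k : ℕ} (i : Fin n) (f : Fin k → Fin n) :
    word (Fin.cons i f : Fin (k + 1) → Fin n) = FreeMonoid.of i * word f := by
  simp [word, List.ofFn_succ]

theorem sum_words_succ {n k : ℕ} {E : Type*} [AddCommMonoid E] (g : Word n → E) :
    ∑ f : Fin (k + 1) → Fin n, g (word f) =
      ∑ i : Fin n, ∑ f : Fin k → Fin n, g (FreeMonoid.of i * word f) := by
  rw [← (Fin.consEquiv fun _ : Fin (k + 1) => Fin n).sum_comp, Fintype.sum_prod_type]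
  refine Finset.sum_congr rfl fun i _ => Finset.sum_congr rfl fun f _ => ?_
  rw [← word_cons]; rfl

theorem sum_words_zero {n : ℕ} {E : Type*} [AddCommMonoid E] (g : Word n → E) :
    ∑ f : Fin 0 → Fin n, g (word f) = g 1 := by
  simp [word]

variable {n : ℕ} {K : Type} [NormedAddCommGroup K] [InnerProductSpace ℂ K]

theorem wordProd_mul (X : Fin n → K →L[ℂ] K) (α β : Word n) :
    wordProd X (α * β) = wordProd X α * wordProd X β := by
  simp [wordProd]

theorem wordProd_one (X : Fin n → K →L[ℂ] K) : wordProd X 1 = 1 := by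
  simp [wordProd]

theorem wordProd_of (X : Fin n → K →L[ℂ] K) (i : Fin n) :
    wordProd X (FreeMonoid.of i) = X i := by
  simp [wordProd]

theorem sum_truncSum (a : Word n → ℂ) (X : Fin n → K →L[ℂ] K) (m : ℕ) :
    ∑ k ∈ Finset.range (m + 1), truncSum a X k = ∑ α ∈ wordsLE n m, a α • wordProd X α := by
  unfold truncSum
  rw [sum_wordsLE (fun α => a α • wordProd X α)]

theorem clm_mul_apply (A B : K →L[ℂ] K) (x : K) : (A * B) x = A (B x) := rfl

variable [CompleteSpace K]

theorem rowsq (X : Fin n → K →L[ℂ] K) (h : K) :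
    ((∑ i, ‖adjoint (X i) h‖ ^ 2 : ℝ) : ℂ) = inner ℂ h ((∑ i, X i * adjoint (X i)) h) := by
  rw [_root_.sum_apply, inner_sum]
  push_cast
  refine Finset.sum_congr rfl fun i _ => ?_
  change _ = inner ℂ h (X i (adjoint (X i) h))
  rw [← adjoint_inner_left, inner_self_eq_norm_sq_to_K]
  rfl

theorem row_le (X : Fin n → K →L[ℂ] K) (h : K) :
    ∑ i, ‖adjoint (X i) h‖ ^ 2 ≤ ‖∑ i, X i * adjoint (X i)‖ * ‖h‖ ^ 2 := by
  have h1 := rowsq X h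
  have h2 : ∑ i, ‖adjoint (X i) h‖ ^ 2 = ‖(inner ℂ h ((∑ i, X i * adjoint (X i)) h) : ℂ)‖ := by
    rw [← h1, Complex.norm_real, Real.norm_of_nonneg]
    positivity
  rw [h2]
  refine (norm_inner_le_norm _ _).trans ?_
  nlinarith [(∑ i, X i * adjoint (X i)).le_opNorm h, norm_nonneg h]

theorem row_norm_le (X : Fin n → K →L[ℂ] K) (c : ℝ) (hc : 0 ≤ c)
    (H : ∀ h, ∑ i, ‖adjoint (X i) h‖ ^ 2 ≤ c * ‖h‖ ^ 2) :
    ‖∑ i, X i * adjoint (X i)‖ ≤ c := by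
  set T := ∑ i, X i * adjoint (X i) with hT
  refine ContinuousLinearMap.opNorm_le_bound _ hc fun h => ?_
  have h1 : ‖T h‖ ^ 2 ≤ ∑ i, ‖adjoint (X i) (T h)‖ * ‖adjoint (X i) h‖ := by
    have : (‖T h‖ ^ 2 : ℝ) = ‖(inner ℂ (T h) (T h) : ℂ)‖ := by
      rw [inner_self_eq_norm_sq_to_K]; simp
    rw [this]
    nth_rewrite 2 [hT]
    rw [_root_.sum_apply, inner_sum]
    refine (norm_sum_le _ _).trans (Finset.sum_le_sum fun i _ => ?_)
    rw [clm_mul_apply, ← adjoint_inner_left]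
    exact norm_inner_le_norm _ _
  have h2 := Finset.sum_mul_sq_le_sq_mul_sq Finset.univ (fun i => ‖adjoint (X i) (T h)‖)
    (fun i => ‖adjoint (X i) h‖)
  have h3 : (‖T h‖ ^ 2) ^ 2 ≤ (c * ‖T h‖ ^ 2) * (c * ‖h‖ ^ 2) := by
    calc (‖T h‖ ^ 2) ^ 2 ≤ (∑ i, ‖adjoint (X i) (T h)‖ * ‖adjoint (X i) h‖) ^ 2 := by gcongr
      _ ≤ _ := h2
      _ ≤ _ := by
        gcongr
        · exact H _
        · exact H _
  rcases eq_or_ne (‖T h‖) 0 with h0 | h0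
  · rw [h0]; positivity
  · have hp : 0 < ‖T h‖ := lt_of_le_of_ne (norm_nonneg _) (Ne.symm h0)
    refine abs_le_of_sq_le_sq' ?_ (by positivity) |>.2
    have : ‖T h‖ ^ 2 * ‖T h‖ ^ 2 ≤ ‖T h‖ ^ 2 * (c * ‖h‖) ^ 2 := by nlinarith
    exact le_of_mul_le_mul_left this (by positivity)

theorem adj_word_cons (X : Fin n → K →L[ℂ] K) (α β : Word n) (h : K) :
    adjoint (wordProd X (α * β)) h = adjoint (wordProd X β) (adjoint (wordProd X α) h) := by
  rw [wordProd_mul]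
  change adjoint ((wordProd X α).comp (wordProd X β)) h = _
  rw [adjoint_comp]; rfl

theorem Q_le (X : Fin n → K →L[ℂ] K) (c : ℝ) (hc : 0 ≤ c)
    (H : ∀ h, ∑ i, ‖adjoint (X i) h‖ ^ 2 ≤ c * ‖h‖ ^ 2) (k : ℕ) (h : K) :
    ∑ f : Fin k → Fin n, ‖adjoint (wordProd X (word f)) h‖ ^ 2 ≤ c ^ k * ‖h‖ ^ 2 := by
  induction k generalizing h with
  | zero =>
    rw [sum_words_zero (fun α => ‖adjoint (wordProd X α) h‖ ^ 2), wordProd_one]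
    simp [← ContinuousLinearMap.star_eq_adjoint]
  | succ k ih =>
    rw [sum_words_succ (fun α => ‖adjoint (wordProd X α) h‖ ^ 2)]
    simp only [adj_word_cons, wordProd_of]
    calc _ ≤ ∑ i, c ^ k * ‖adjoint (X i) h‖ ^ 2 := Finset.sum_le_sum fun i _ => ih _
      _ = c ^ k * ∑ i, ‖adjoint (X i) h‖ ^ 2 := by rw [Finset.mul_sum]
      _ ≤ c ^ k * (c * ‖h‖ ^ 2) := by gcongr; exact H h
      _ = _ := by ring

theorem P_eq (X : Fin n → K →L[ℂ] K) (D : K →L[ℂ] K)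
    (H : ∀ h, ‖D h‖ ^ 2 = ‖h‖ ^ 2 - ∑ i, ‖adjoint (X i) h‖ ^ 2) (k : ℕ) (h : K) :
    ∑ f : Fin k → Fin n, ‖D (adjoint (wordProd X (word f)) h)‖ ^ 2 =
      ∑ f : Fin k → Fin n, ‖adjoint (wordProd X (word f)) h‖ ^ 2 -
      ∑ f : Fin (k + 1) → Fin n, ‖adjoint (wordProd X (word f)) h‖ ^ 2 := by
  induction k generalizing h with
  | zero =>
    rw [sum_words_zero (fun α => ‖D (adjoint (wordProd X α) h)‖ ^ 2),
      sum_words_succ (fun α => ‖adjoint (wordProd X α) h‖ ^ 2),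
      sum_words_zero (fun α => ‖adjoint (wordProd X α) h‖ ^ 2), wordProd_one]
    have : adjoint (1 : K →L[ℂ] K) = 1 := by simp [← ContinuousLinearMap.star_eq_adjoint]
    rw [this]
    simp only [one_apply_eq_self, H]
    congr 1
    refine Finset.sum_congr rfl fun i _ => ?_
    rw [sum_words_zero (fun α => ‖adjoint (wordProd X (FreeMonoid.of i * α)) h‖ ^ 2)]
    rw [mul_one, wordProd_of]
  | succ k ih =>
    rw [sum_words_succ (fun α => ‖D (adjoint (wordProd X α) h)‖ ^ 2),
      sum_words_succ (fun α => ‖adjoint (wordProd X α) h‖ ^ 2),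
      sum_words_succ (fun α => ‖adjoint (wordProd X α) h‖ ^ 2), ← Finset.sum_sub_distrib]
    refine Finset.sum_congr rfl fun i _ => ?_
    simp only [adj_word_cons, wordProd_of]
    exact ih _

theorem P_sum (X : Fin n → K →L[ℂ] K) (D : K →L[ℂ] K)
    (H : ∀ h, ‖D h‖ ^ 2 = ‖h‖ ^ 2 - ∑ i, ‖adjoint (X i) h‖ ^ 2) (N : ℕ) (h : K) :
    ∑ α ∈ wordsLE n N, ‖D (adjoint (wordProd X α) h)‖ ^ 2 =
      ‖h‖ ^ 2 - ∑ f : Fin (N + 1) → Fin n, ‖adjoint (wordProd X (word f)) h‖ ^ 2 := by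
  rw [← sum_wordsLE (fun α => ‖D (adjoint (wordProd X α) h)‖ ^ 2)]
  simp only [P_eq X D H]
  rw [Finset.sum_range_sub']
  congr 1
  rw [sum_words_zero (fun α => ‖adjoint (wordProd X α) h‖ ^ 2), wordProd_one]
  simp [← ContinuousLinearMap.star_eq_adjoint]

theorem exists_D (X : Fin n → K →L[ℂ] K) (hX : ‖∑ i, X i * adjoint (X i)‖ ≤ 1) :
    ∃ D : K →L[ℂ] K, ∀ h, ‖D h‖ ^ 2 = ‖h‖ ^ 2 - ∑ i, ‖adjoint (X i) h‖ ^ 2 := by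
  set T := ∑ i, X i * adjoint (X i) with hT
  have hTp : 0 ≤ T := by
    refine Finset.sum_nonneg fun i _ => ?_
    exact mul_star_self_nonneg (X i)
  have hT1 : 0 ≤ 1 - T := by
    rw [sub_nonneg]
    exact (CStarAlgebra.norm_le_one_iff_of_nonneg T hTp).1 hX
  refine ⟨CFC.sqrt (1 - T), fun h => ?_⟩
  have h1 := CFC.sqrt_mul_sqrt_self (1 - T) hT1
  have h2 : IsSelfAdjoint (CFC.sqrt (1 - T)) := (CFC.sqrt_nonneg (1 - T)).isSelfAdjoint
  set D := CFC.sqrt (1 - T)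
  have h3 : adjoint D = D := h2
  have h4 : ((‖D h‖ ^ 2 : ℝ) : ℂ) = inner ℂ h ((1 - T) h) := by
    rw [← h1, clm_mul_apply, ← adjoint_inner_left, h3,
      inner_self_eq_norm_sq_to_K]
    simp
  rw [_root_.sub_apply, inner_sub_right, hT, ← rowsq,
    one_apply_eq_self, inner_self_eq_norm_sq_to_K] at h4
  apply Complex.ofReal_injective
  rw [h4]
  push_cast
  rfl

theorem truncSum_norm_le (a : Word n → ℂ) (X : Fin n → K →L[ℂ] K) (c : ℝ) (hc : 0 ≤ c)
    (H : ∀ h, ∑ i, ‖adjoint (X i) h‖ ^ 2 ≤ c * ‖h‖ ^ 2) (k : ℕ) :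
    ‖truncSum a X k‖ ^ 2 ≤ (∑ f : Fin k → Fin n, ‖a (word f)‖ ^ 2) * c ^ k := by
  have hs : 0 ≤ (∑ f : Fin k → Fin n, ‖a (word f)‖ ^ 2) * c ^ k := by positivity
  have : ‖adjoint (truncSum a X k)‖ ≤ √((∑ f : Fin k → Fin n, ‖a (word f)‖ ^ 2) * c ^ k) := by
    refine ContinuousLinearMap.opNorm_le_bound _ (Real.sqrt_nonneg _) fun h => ?_
    refine abs_le_of_sq_le_sq' ?_ (by positivity) |>.2
    rw [mul_pow, Real.sq_sqrt hs]
    have e1 : ‖adjoint (truncSum a X k) h‖ ≤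
        ∑ f : Fin k → Fin n, ‖a (word f)‖ * ‖adjoint (wordProd X (word f)) h‖ := by
      unfold truncSum
      rw [map_sum, _root_.sum_apply]
      refine (norm_sum_le _ _).trans (le_of_eq (Finset.sum_congr rfl fun f _ => ?_))
      rw [map_smulₛₗ, _root_.smul_apply, norm_smul]
      simp
    calc _ ≤ (∑ f : Fin k → Fin n, ‖a (word f)‖ * ‖adjoint (wordProd X (word f)) h‖) ^ 2 := by
          gcongr
      _ ≤ _ := Finset.sum_mul_sq_le_sq_mul_sq _ _ _
      _ ≤ (∑ f : Fin k → Fin n, ‖a (word f)‖ ^ 2) * (c ^ k * ‖h‖ ^ 2) := by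
          gcongr; exact Q_le X c hc H k h
      _ = _ := by ring
  rw [LinearIsometryEquiv.norm_map] at this
  calc _ ≤ _ := by gcongr
    _ = _ := Real.sq_sqrt hs

theorem radCond_bound (a : Word n → ℂ) (ha : radCond 1 a) (ρ : ℝ) (hρ : 1 < ρ) :
    ∀ᶠ k : ℕ in atTop, ∑ f : Fin k → Fin n, ‖a (word f)‖ ^ 2 ≤ ρ ^ (2 * k) := by
  unfold radCond at ha
  have h1 : Filter.limsup
    (fun k : ℕ =>
      (∑ f : Fin k → Fin n, (‖a (word f)‖₊ : ℝ≥0∞) ^ 2) ^ ((1 : ℝ) / (2 * (k : ℝ))))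
    Filter.atTop < ENNReal.ofReal ρ := by
    refine ha.trans_lt ?_
    rw [ENNReal.ofReal_lt_ofReal_iff (by linarith)]
    simpa using hρ
  filter_upwards [Filter.eventually_lt_of_limsup_lt h1, eventually_gt_atTop 0] with k hk hk0
  have hk' : (0 : ℝ) < 2 * (k : ℝ) := by positivity
  have h2 := ENNReal.rpow_le_rpow hk.le hk'.le
  rw [← ENNReal.rpow_mul, one_div, inv_mul_cancel₀ hk'.ne', ENNReal.rpow_one] at h2
  have h3 : (∑ f : Fin k → Fin n, (‖a (word f)‖₊ : ℝ≥0∞) ^ 2) =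
      ENNReal.ofReal (∑ f : Fin k → Fin n, ‖a (word f)‖ ^ 2) := by
    rw [ENNReal.ofReal_sum_of_nonneg (fun _ _ => by positivity)]
    refine Finset.sum_congr rfl fun f _ => ?_
    rw [ENNReal.ofReal_pow (norm_nonneg _), ofReal_norm]
    rfl
  rw [h3, show (2 * (k : ℝ)) = ((2 * k : ℕ) : ℝ) by push_cast; ring, ENNReal.rpow_natCast,
    ← ENNReal.ofReal_pow (by linarith)] at h2
  exact (ENNReal.ofReal_le_ofReal_iff (by positivity)).1 h2

theorem summable_truncSum (a : Word n → ℂ) (ha : radCond 1 a) (X : Fin n → K →L[ℂ] K)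
    (hX : inBall 1 X) : Summable (truncSum a X) := by
  set c := ‖∑ i, X i * adjoint (X i)‖ with hc
  have hc0 : 0 ≤ c := norm_nonneg _
  have hc1 : c < 1 := by simpa [inBall] using hX
  have hs1 : √c < 1 := by rw [Real.sqrt_lt' one_pos]; simpa using hc1
  have hs0 : 0 ≤ √c := Real.sqrt_nonneg _
  obtain ⟨ρ, h1, h2⟩ : ∃ ρ : ℝ, 1 < ρ ∧ ρ * √c < 1 := by
    refine ⟨2 / (1 + √c), ?_, ?_⟩
    · rw [lt_div_iff₀ (by positivity)]; linarith
    · rw [div_mul_eq_mul_div, div_lt_one (by positivity)]; linarith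
  have hg : Summable fun k : ℕ => (ρ * √c) ^ k :=
    summable_geometric_of_lt_one (by positivity) h2
  refine Summable.of_norm_bounded_eventually_nat hg ?_
  filter_upwards [radCond_bound a ha ρ h1] with k hk
  refine abs_le_of_sq_le_sq' ?_ (by positivity) |>.2
  refine (truncSum_norm_le a X c hc0 (row_le X) k).trans ?_
  calc _ ≤ ρ ^ (2 * k) * c ^ k := by gcongr
    _ = ρ ^ (2 * k) * (√c ^ 2) ^ k := by rw [Real.sq_sqrt hc0]
    _ = _ := by ring


variable {F : Type} [NormedAddCommGroup F] [InnerProductSpace ℂ F] [CompleteSpace F]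

theorem hb_ext (e : HilbertBasis (Word n) ℂ F) (A B : F →L[ℂ] F) (h : ∀ α, A (e α) = B (e α)) :
    A = B := by
  refine ContinuousLinearMap.ext_on (s := Set.range e) ?_ ?_
  · have := e.dense_span
    rwa [← Submodule.dense_iff_topologicalClosure_eq_top] at this
  · rintro _ ⟨α, rfl⟩
    exact h α

theorem S_word (e : HilbertBasis (Word n) ℂ F) (m : ℕ) (S : Fin n → F →L[ℂ] F)
    (hS : ∀ (i : Fin n) (α : Word n),
      S i (e α) = if wordLen α < m then e (FreeMonoid.of i * α) else 0) (α β : Word n) :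
    wordProd S α (e β) =
      if wordLen α + wordLen β ≤ m ∨ wordLen α = 0 then e (α * β) else 0 := by
  induction α using FreeMonoid.inductionOn' with
  | one => simp [wordProd_one, wordLen_one]
  | of_mul i l ih =>
    have hl : wordLen (FreeMonoid.of i * l) = wordLen l + 1 := by
      rw [wordLen_mul, add_comm]; rfl
    rw [wordProd_mul, clm_mul_apply, ih, wordProd_of, hl]
    by_cases h1 : wordLen l + wordLen β ≤ m ∨ wordLen l = 0
    · rw [if_pos h1, hS, wordLen_mul, mul_assoc]
      by_cases h2 : wordLen l + wordLen β < m
      · rw [if_pos h2, if_pos (by omega)]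
      · rw [if_neg h2, if_neg (by omega)]
    · rw [if_neg h1, map_zero, if_neg (by omega)]

theorem S_trunc_zero (e : HilbertBasis (Word n) ℂ F) (m : ℕ) (S : Fin n → F →L[ℂ] F)
    (hS : ∀ (i : Fin n) (α : Word n),
      S i (e α) = if wordLen α < m then e (FreeMonoid.of i * α) else 0)
    (a : Word n → ℂ) (k : ℕ) (hk : m < k) : truncSum a S k = 0 := by
  unfold truncSum
  refine Finset.sum_eq_zero fun f _ => ?_
  have : wordProd S (word f) = 0 := by
    refine hb_ext e _ _ fun β => ?_
    rw [S_word e m S hS, wordLen_word, if_neg (by omega)]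
    simp
  rw [this, smul_zero]

theorem S_row (e : HilbertBasis (Word n) ℂ F) (m : ℕ) (S : Fin n → F →L[ℂ] F)
    (hS : ∀ (i : Fin n) (α : Word n),
      S i (e α) = if wordLen α < m then e (FreeMonoid.of i * α) else 0) (x : F) :
    ∑ i, ‖adjoint (S i) x‖ ^ 2 ≤ ‖x‖ ^ 2 := by
  have hp : ∀ y : F, HasSum (fun γ => ‖(inner ℂ (e γ) y : ℂ)‖ ^ 2) (‖y‖ ^ 2) := by
    intro y
    have h1 := Complex.hasSum_re (e.hasSum_inner_mul_inner y y)
    have h2 : (inner ℂ y y : ℂ).re = ‖y‖ ^ 2 := inner_self_eq_norm_sq (𝕜 := ℂ) y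
    rw [h2] at h1
    convert h1 using 2 with γ
    rw [← inner_conj_symm y (e γ), Complex.conj_mul']
    norm_cast
  have ht := hasSum_sum (s := Finset.univ) (fun i _ => hp (adjoint (S i) x))
  refine le_of_tendsto' ht fun s => ?_
  rw [Finset.sum_comm, ← Finset.sum_product' (s := Finset.univ) (t := s)
    (f := fun i γ => ‖(inner ℂ (e γ) (adjoint (S i) x) : ℂ)‖ ^ 2)]
  have ho : Orthonormal ℂ (fun p : Fin n × Word n => e (FreeMonoid.of p.1 * p.2)) := by
    refine e.orthonormal.comp (fun p : Fin n × Word n => FreeMonoid.of p.1 * p.2) ?_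
    rintro ⟨i, α⟩ ⟨j, β⟩ h
    have h' : i :: FreeMonoid.toList α = j :: FreeMonoid.toList β := h
    rw [List.cons.injEq] at h'
    exact Prod.ext h'.1 h'.2
  refine le_trans (Finset.sum_le_sum ?_) (ho.sum_inner_products_le x (s := Finset.univ ×ˢ s))
  rintro ⟨i, γ⟩ _
  simp only
  rw [adjoint_inner_right, hS]
  split_ifs
  · exact le_rfl
  · simp

theorem scalar_ineq (e : HilbertBasis (Word n) ℂ F) (m : ℕ) (S : Fin n → F →L[ℂ] F)
    (hS : ∀ (i : Fin n) (α : Word n),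
      S i (e α) = if wordLen α < m then e (FreeMonoid.of i * α) else 0)
    (a : Word n → ℂ) (M : ℝ) (hM : ‖∑ k ∈ Finset.range (m + 1), truncSum a S k‖ ≤ M)
    (c : Word n → ℂ) :
    ∑ α ∈ wordsLE n m, ‖∑ β ∈ wordsLE n (m - wordLen α), starRingEnd ℂ (a β) * c (β * α)‖ ^ 2 ≤
      M ^ 2 * ∑ γ ∈ wordsLE n m, ‖c γ‖ ^ 2 := by
  set A := ∑ k ∈ Finset.range (m + 1), truncSum a S k with hA
  rw [sum_truncSum] at hA
  set x : F := ∑ γ ∈ wordsLE n m, c γ • e γ with hx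
  have hxn : ‖x‖ ^ 2 = ∑ γ ∈ wordsLE n m, ‖c γ‖ ^ 2 := by
    apply Complex.ofReal_injective
    have h1 := e.orthonormal.inner_sum c c (wordsLE n m)
    rw [← hx, inner_self_eq_norm_sq_to_K] at h1
    push_cast
    refine Eq.trans h1 (Finset.sum_congr rfl fun γ _ => ?_)
    rw [Complex.conj_mul']
  have hAx : ‖adjoint A x‖ ^ 2 ≤ M ^ 2 * ‖x‖ ^ 2 := by
    rw [← mul_pow]
    have h1 := (adjoint A).le_opNorm x
    rw [LinearIsometryEquiv.norm_map] at h1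
    have : ‖adjoint A x‖ ≤ M * ‖x‖ := h1.trans (by gcongr)
    gcongr
  rw [← hxn]
  refine le_trans (le_of_eq (Finset.sum_congr rfl fun α hα => ?_))
    ((e.orthonormal.sum_inner_products_le (adjoint A x) (s := wordsLE n m)).trans hAx)
  rw [mem_wordsLE] at hα
  congr 2
  rw [adjoint_inner_right, hA, _root_.sum_apply, sum_inner]
  have hsub : wordsLE n (m - wordLen α) ⊆ wordsLE n m := by
    intro β hβ
    rw [mem_wordsLE] at *
    omega
  rw [← Finset.sum_subset hsub]
  · refine Finset.sum_congr rfl fun β hβ => ?_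
    rw [mem_wordsLE] at hβ
    rw [_root_.smul_apply, S_word e m S hS, if_pos (by omega), inner_smul_left, hx,
      e.orthonormal.inner_right_sum]
    rw [mem_wordsLE, wordLen_mul]
    omega
  · intro β _ hβ
    rw [mem_wordsLE] at hβ
    rw [_root_.smul_apply, S_word e m S hS, if_neg (by omega)]
    simp

theorem vec_ineq_fin (e : HilbertBasis (Word n) ℂ F) (m : ℕ) (S : Fin n → F →L[ℂ] F)
    (hS : ∀ (i : Fin n) (α : Word n),
      S i (e α) = if wordLen α < m then e (FreeMonoid.of i * α) else 0)
    (a : Word n → ℂ) (M : ℝ) (hM : ‖∑ k ∈ Finset.range (m + 1), truncSum a S k‖ ≤ M)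
    {E : Type} [NormedAddCommGroup E] [InnerProductSpace ℂ E] [FiniteDimensional ℂ E]
    (y : Word n → E) :
    ∑ α ∈ wordsLE n m, ‖∑ β ∈ wordsLE n (m - wordLen α), starRingEnd ℂ (a β) • y (β * α)‖ ^ 2 ≤
      M ^ 2 * ∑ γ ∈ wordsLE n m, ‖y γ‖ ^ 2 := by
  let b := stdOrthonormalBasis ℂ E
  simp only [← b.sum_sq_norm_inner_right]
  rw [Finset.sum_comm, Finset.sum_comm (s := wordsLE n m), Finset.mul_sum]
  refine Finset.sum_le_sum fun j _ => ?_
  refine le_trans (le_of_eq ?_) (scalar_ineq e m S hS a M hM (fun γ => inner ℂ (b j) (y γ)))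
  refine Finset.sum_congr rfl fun α _ => ?_
  rw [inner_sum]
  simp only [inner_smul_right]

theorem vec_ineq (e : HilbertBasis (Word n) ℂ F) (m : ℕ) (S : Fin n → F →L[ℂ] F)
    (hS : ∀ (i : Fin n) (α : Word n),
      S i (e α) = if wordLen α < m then e (FreeMonoid.of i * α) else 0)
    (a : Word n → ℂ) (M : ℝ) (hM : ‖∑ k ∈ Finset.range (m + 1), truncSum a S k‖ ≤ M)
    (y : Word n → K) :
    ∑ α ∈ wordsLE n m, ‖∑ β ∈ wordsLE n (m - wordLen α), starRingEnd ℂ (a β) • y (β * α)‖ ^ 2 ≤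
      M ^ 2 * ∑ γ ∈ wordsLE n m, ‖y γ‖ ^ 2 := by
  classical
  let W : Submodule ℂ K := Submodule.span ℂ ((wordsLE n m).image y : Set K)
  haveI : FiniteDimensional ℂ W := FiniteDimensional.span_of_finite ℂ (Finset.finite_toSet _)
  have hy : ∀ γ, wordLen γ ≤ m → y γ ∈ W := by
    intro γ hγ
    refine Submodule.subset_span ?_
    exact Finset.mem_coe.2 (Finset.mem_image_of_mem _ (mem_wordsLE.2 hγ))
  let p := W.orthogonalProjectionOnto
  have hp : ∀ v ∈ W, ‖p v‖ = ‖v‖ := by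
    intro v hv
    have := Submodule.orthogonalProjectionOnto_mem_subspace_eq_self (⟨v, hv⟩ : W)
    simp only at this
    change ‖W.orthogonalProjectionOnto v‖ = _
    rw [this]; rfl
  have h := vec_ineq_fin e m S hS a M hM (fun γ => p (y γ))
  refine le_trans (le_of_eq ?_) (h.trans ?_)
  · refine Finset.sum_congr rfl fun α hα => ?_
    rw [mem_wordsLE] at hα
    rw [← hp]
    · rw [map_sum]; simp only [map_smul]
    · refine Submodule.sum_mem _ fun β hβ => Submodule.smul_mem _ _ (hy _ ?_)
      rw [mem_wordsLE] at hβ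
      rw [wordLen_mul]; omega
  · gcongr
    exact Submodule.norm_orthogonalProjectionOnto_apply_le W _

theorem dir2 (e : HilbertBasis (Word n) ℂ F) (Sm : ℕ → Fin n → F →L[ℂ] F)
    (hSm : ∀ (m : ℕ) (i : Fin n) (α : Word n),
      Sm m i (e α) = if wordLen α < m then e (FreeMonoid.of i * α) else 0)
    (a : Word n → ℂ) (ha : radCond 1 a) (M : ℝ)
    (hM : ∀ m, ‖∑ k ∈ Finset.range (m + 1), truncSum a (Sm m) k‖ ≤ M)
    (X : Fin n → K →L[ℂ] K) (hX : inBall 1 X) : ‖holOp a X‖ ≤ M := by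
  have hM0 : 0 ≤ M := (norm_nonneg _).trans (hM 0)
  have hsum := summable_truncSum a ha X hX
  set c := ‖∑ i, X i * adjoint (X i)‖ with hc
  have hc0 : 0 ≤ c := norm_nonneg _
  have hc1 : c < 1 := by simpa [inBall] using hX
  obtain ⟨D, hD⟩ := exists_D X hc1.le
  rw [← LinearIsometryEquiv.norm_map (adjoint (𝕜 := ℂ) (E := K) (F := K))]
  refine ContinuousLinearMap.opNorm_le_bound _ hM0 fun h => ?_
  set v := adjoint (holOp a X) h with hv
  refine abs_le_of_sq_le_sq' ?_ (by positivity) |>.2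
  -- the partial sums converge
  have hlim : Tendsto (fun m : ℕ => ∑ β ∈ wordsLE n m,
      starRingEnd ℂ (a β) • adjoint (wordProd X β) h) atTop (nhds v) := by
    have h1 : Tendsto (fun m : ℕ => ∑ k ∈ Finset.range (m + 1), truncSum a X k) atTop
        (nhds (holOp a X)) := (tendsto_add_atTop_iff_nat 1).2 hsum.hasSum.tendsto_sum_nat
    have h2 : Continuous fun T : K →L[ℂ] K => adjoint T h := by
      have : Continuous fun T : K →L[ℂ] K => adjoint T := LinearIsometryEquiv.continuous _
      exact this.clm_apply continuous_const
    refine ((h2.tendsto _).comp h1).congr fun m => ?_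
    simp only [Function.comp_apply]
    rw [sum_truncSum, map_sum, _root_.sum_apply]
    refine Finset.sum_congr rfl fun β _ => ?_
    rw [map_smulₛₗ, _root_.smul_apply]
  have hN : ∀ N : ℕ, ∑ α ∈ wordsLE n N, ‖D (adjoint (wordProd X α) v)‖ ^ 2 ≤ (M * ‖h‖) ^ 2 := by
    intro N
    have hl : Tendsto (fun m : ℕ => ∑ α ∈ wordsLE n N, ‖∑ β ∈ wordsLE n (m - wordLen α),
        starRingEnd ℂ (a β) • D (adjoint (wordProd X (β * α)) h)‖ ^ 2) atTop
        (nhds (∑ α ∈ wordsLE n N, ‖D (adjoint (wordProd X α) v)‖ ^ 2)) := by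
      refine tendsto_finset_sum _ fun α _ => ?_
      refine (Tendsto.norm ?_).pow 2
      have h1 := hlim.comp (tendsto_sub_atTop_nat (wordLen α))
      have h2 : Continuous fun u => D (adjoint (wordProd X α) u) := by fun_prop
      refine ((h2.tendsto _).comp h1).congr fun m => ?_
      simp only [Function.comp_apply, map_sum, map_smul, adj_word_cons]
    refine le_of_tendsto hl ?_
    filter_upwards [eventually_ge_atTop N] with m hm
    have h3 := vec_ineq e m (Sm m) (hSm m) a M (hM m) (fun γ => D (adjoint (wordProd X γ) h))
    have hsub : wordsLE n N ⊆ wordsLE n m := by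
      intro β hβ
      rw [mem_wordsLE] at *
      omega
    refine (Finset.sum_le_sum_of_subset_of_nonneg hsub fun _ _ _ => by positivity).trans
      (h3.trans ?_)
    rw [mul_pow, P_sum X D hD]
    gcongr
    have : 0 ≤ ∑ f : Fin (m + 1) → Fin n, ‖adjoint (wordProd X (word f)) h‖ ^ 2 := by positivity
    linarith
  have hle : ∀ N : ℕ, ‖v‖ ^ 2 - c ^ (N + 1) * ‖v‖ ^ 2 ≤ (M * ‖h‖) ^ 2 := by
    intro N
    have h1 := hN N
    rw [P_sum X D hD] at h1
    have h2 := Q_le X c hc0 (row_le X) (N + 1) v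
    linarith
  have ht : Tendsto (fun N : ℕ => ‖v‖ ^ 2 - c ^ (N + 1) * ‖v‖ ^ 2) atTop
      (nhds (‖v‖ ^ 2 - 0 * ‖v‖ ^ 2)) := by
    refine tendsto_const_nhds.sub (Tendsto.mul_const _ ?_)
    exact (tendsto_add_atTop_iff_nat 1).2 (tendsto_pow_atTop_nhds_zero_of_lt_one hc0 hc1)
  have := le_of_tendsto' ht hle
  simpa using this

theorem exists_isometry (hK : ¬ FiniteDimensional ℂ K) (e : HilbertBasis (Word n) ℂ F) :
    Nonempty (F →ₗᵢ[ℂ] K) := by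
  obtain ⟨w, b, hb⟩ := exists_hilbertBasis ℂ K
  have hw : Infinite w := by
    by_contra hcon
    rw [not_infinite_iff_finite] at hcon
    haveI := Fintype.ofFinite w
    exact hK (b.toOrthonormalBasis.toBasis.finiteDimensional_of_finite)
  haveI : Countable (Word n) := inferInstanceAs (Countable (List (Fin n)))
  obtain ⟨g, hg⟩ := exists_injective_nat (Word n)
  have ho : Orthonormal ℂ (fun α : Word n => b (Infinite.natEmbedding w (g α))) :=
    b.orthonormal.comp _ ((Infinite.natEmbedding w).injective.comp hg)
  exact ⟨ho.orthogonalFamily.linearIsometry.comp e.repr.toLinearIsometry⟩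

theorem dir1 (hK : ¬ FiniteDimensional ℂ K)
    (e : HilbertBasis (Word n) ℂ F) (m : ℕ) (S : Fin n → F →L[ℂ] F)
    (hS : ∀ (i : Fin n) (α : Word n),
      S i (e α) = if wordLen α < m then e (FreeMonoid.of i * α) else 0)
    (a : Word n → ℂ) (ha : radCond 1 a) (M : ℝ)
    (hM : ∀ X : Fin n → K →L[ℂ] K, inBall 1 X → ‖holOp a X‖ ≤ M) :
    ‖∑ k ∈ Finset.range (m + 1), truncSum a S k‖ ≤ M := by
  obtain ⟨V₀⟩ := exists_isometry hK e
  set V : F →L[ℂ] K := V₀.toContinuousLinearMap with hV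
  have hVn : ∀ x, ‖V x‖ = ‖x‖ := fun x => V₀.norm_map x
  have hVV : ∀ x, adjoint V (V x) = x := by
    intro x
    refine ext_inner_left ℂ fun y => ?_
    rw [adjoint_inner_right]
    exact V₀.inner_map_map y x
  have hV1 : ‖adjoint V‖ ≤ 1 := by
    rw [LinearIsometryEquiv.norm_map]
    exact ContinuousLinearMap.opNorm_le_bound _ zero_le_one fun x => by rw [hVn]; simp
  have key : ∀ r : ℝ, 0 ≤ r → r < 1 →
      ‖∑ k ∈ Finset.range (m + 1), (r : ℂ) ^ k • truncSum a S k‖ ≤ M := by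
    intro r hr0 hr1
    let X : Fin n → K →L[ℂ] K := fun i => (r : ℂ) • (V.comp ((S i).comp (adjoint V)))
    have hXV : ∀ i x, X i (V x) = (r : ℂ) • V (S i x) := by
      intro i x
      simp only [X, _root_.smul_apply, ContinuousLinearMap.comp_apply, hVV]
    have hXw : ∀ α x, wordProd X α (V x) = (r : ℂ) ^ wordLen α • V (wordProd S α x) := by
      intro α
      induction α using FreeMonoid.inductionOn' with
      | one => intro x; simp [wordProd_one, wordLen_one]
      | of_mul i l ih =>
        intro x
        have hl : wordLen (FreeMonoid.of i * l) = wordLen l + 1 := by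
          rw [wordLen_mul, add_comm]; rfl
        rw [wordProd_mul, wordProd_mul, clm_mul_apply, clm_mul_apply, ih, wordProd_of,
          wordProd_of, map_smul, hXV, hl, smul_smul, pow_succ]
    have hXt : ∀ k x, truncSum a X k (V x) = V (((r : ℂ) ^ k • truncSum a S k) x) := by
      intro k x
      simp only [truncSum, _root_.sum_apply, _root_.smul_apply, map_sum, map_smul,
        Finset.smul_sum, hXw, wordLen_word]
      refine Finset.sum_congr rfl fun f _ => ?_
      rw [smul_comm]
    have hadj : ∀ i, adjoint (X i) = (r : ℂ) • (V.comp ((adjoint (S i)).comp (adjoint V))) := by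
      intro i
      simp only [X]
      rw [map_smulₛₗ, adjoint_comp, adjoint_comp, adjoint_adjoint, Complex.conj_ofReal]
      rfl
    have hball : inBall 1 X := by
      unfold inBall
      have h1 : ‖∑ i, X i * adjoint (X i)‖ ≤ r ^ 2 := by
        refine row_norm_le X _ (by positivity) fun h => ?_
        have h2 := S_row e m S hS (adjoint V h)
        have h3 : ‖adjoint V h‖ ≤ ‖h‖ := by
          have := (adjoint V).le_opNorm h
          nlinarith [norm_nonneg h]
        calc _ = r ^ 2 * ∑ i, ‖adjoint (S i) (adjoint V h)‖ ^ 2 := by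
              rw [Finset.mul_sum]
              refine Finset.sum_congr rfl fun i _ => ?_
              rw [hadj, _root_.smul_apply, norm_smul, ContinuousLinearMap.comp_apply, hVn,
                ContinuousLinearMap.comp_apply, mul_pow, Complex.norm_real, Real.norm_eq_abs,
                sq_abs]
          _ ≤ r ^ 2 * ‖h‖ ^ 2 := by
              gcongr
              exact h2.trans (by gcongr)
      refine h1.trans_lt ?_
      nlinarith
    have hs := (summable_truncSum a ha X hball).hasSum
    refine ContinuousLinearMap.opNorm_le_bound _ ((norm_nonneg _).trans (hM X hball)) fun x => ?_
    have h4 : holOp a X (V x) =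
        V ((∑ k ∈ Finset.range (m + 1), (r : ℂ) ^ k • truncSum a S k) x) := by
      have h5 : HasSum (fun k => truncSum a X k (V x)) (holOp a X (V x)) :=
        hs.mapL (ContinuousLinearMap.apply ℂ K (V x))
      have h6 : HasSum (fun k => truncSum a X k (V x))
          (∑ k ∈ Finset.range (m + 1), truncSum a X k (V x)) := by
        refine hasSum_sum_of_ne_finset_zero fun k hk => ?_
        rw [Finset.mem_range] at hk
        rw [hXt, S_trunc_zero e m S hS a k (by omega)]
        simp
      rw [h5.unique h6, _root_.sum_apply, map_sum]
      exact Finset.sum_congr rfl fun k _ => hXt k x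
    rw [← hVn, ← h4, ← hVn x]
    exact (ContinuousLinearMap.le_opNorm _ _).trans (by gcongr; exact hM X hball)
  have hcont : Continuous fun r : ℝ =>
      ‖∑ k ∈ Finset.range (m + 1), (r : ℂ) ^ k • truncSum a S k‖ := by
    fun_prop
  have ht := (hcont.tendsto 1).mono_left (nhdsWithin_le_nhds (s := Set.Iio 1))
  have := le_of_tendsto ht (b := M) (by
    have h0 : Set.Ioo (0 : ℝ) 1 ∈ nhdsWithin (1 : ℝ) (Set.Iio 1) :=
      Ioo_mem_nhdsLT zero_lt_one
    filter_upwards [h0] with r hr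
    exact key r hr.1.le hr.2)
  simpa using this

end Aux

/-- A free holomorphic function is bounded on the unit ball of an
infinite-dimensional Hilbert space iff the truncations `Σ_{|α| ≤ m} a_α S_α^{(m)}` are
uniformly bounded; in that case the two suprema coincide.  (The compression `S_i^{(m)}` of
the left creation operator to polynomials of degree `≤ m`, extended by `0`, is the operator
`Sm m i` determined by `Sm m i e_α = e_{g_i α}` if `|α| < m` and `0` otherwise.) -/
theorem stmt_11 (n : ℕ) (hn : 1 ≤ n)
    (H : Type) [NormedAddCommGroup H] [InnerProductSpace ℂ H] [CompleteSpace H]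
    (hH : ¬ FiniteDimensional ℂ H)
    (F : Type) [NormedAddCommGroup F] [InnerProductSpace ℂ F] [CompleteSpace F]
    (e : HilbertBasis (Word n) ℂ F)
    (Sm : ℕ → Fin n → F →L[ℂ] F)
    (hSm : ∀ (m : ℕ) (i : Fin n) (α : Word n),
      Sm m i (e α) = if wordLen α < m then e (FreeMonoid.of i * α) else 0)
    (a : Word n → ℂ) (ha : radCond 1 a) :
    ((∃ M : ℝ, ∀ X : Fin n → H →L[ℂ] H, inBall 1 X → ‖holOp a X‖ ≤ M) ↔
      (∃ M : ℝ, ∀ m : ℕ, ‖∑ k ∈ Finset.range (m + 1), truncSum a (Sm m) k‖ ≤ M)) ∧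
    ((∃ M : ℝ, ∀ X : Fin n → H →L[ℂ] H, inBall 1 X → ‖holOp a X‖ ≤ M) →
      sSup ((fun X : Fin n → H →L[ℂ] H => ‖holOp a X‖) '' {X | inBall 1 X}) =
        sSup (Set.range fun m : ℕ => ‖∑ k ∈ Finset.range (m + 1), truncSum a (Sm m) k‖)) := by
  have iff : ∀ M : ℝ, (∀ X : Fin n → H →L[ℂ] H, inBall 1 X → ‖holOp a X‖ ≤ M) ↔
      (∀ m : ℕ, ‖∑ k ∈ Finset.range (m + 1), truncSum a (Sm m) k‖ ≤ M) := fun M =>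
    ⟨fun h m => dir1 hH e m (Sm m) (hSm m) a ha M h,
      fun h X hX => dir2 e Sm hSm a ha M h X hX⟩
  refine ⟨exists_congr iff, ?_⟩
  rintro ⟨M, hM⟩
  have h1 : IsLUB ((fun X : Fin n → H →L[ℂ] H => ‖holOp a X‖) '' {X | inBall 1 X})
      (sSup ((fun X : Fin n → H →L[ℂ] H => ‖holOp a X‖) '' {X | inBall 1 X})) := by
    refine isLUB_csSup ⟨_, 0, ?_, rfl⟩ ⟨M, ?_⟩
    · simp [inBall]
    · rintro _ ⟨X, hX, rfl⟩
      exact hM X hX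
  have h2 : IsLUB (Set.range fun m : ℕ => ‖∑ k ∈ Finset.range (m + 1), truncSum a (Sm m) k‖)
      (sSup (Set.range fun m : ℕ =>
        ‖∑ k ∈ Finset.range (m + 1), truncSum a (Sm m) k‖)) := by
    refine isLUB_csSup (Set.range_nonempty _) ⟨M, ?_⟩
    rintro _ ⟨m, rfl⟩
    exact (iff M).1 hM m
  have h3 : upperBounds ((fun X : Fin n → H →L[ℂ] H => ‖holOp a X‖) '' {X | inBall 1 X}) =
      upperBounds (Set.range fun m : ℕ =>
        ‖∑ k ∈ Finset.range (m + 1), truncSum a (Sm m) k‖) := by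
    ext B
    constructor
    · rintro hB _ ⟨m, rfl⟩
      exact (iff B).1 (fun X hX => hB ⟨X, hX, rfl⟩) m
    · rintro hB _ ⟨X, hX, rfl⟩
      exact (iff B).2 (fun m => hB ⟨m, rfl⟩) X hX
  rw [IsLUB, h3] at h1
  exact h1.unique h2


end
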